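/- Let d ≥ 1, 1 ≤ n ≤ d, and let v be a unit vector in ℂ^d ⊗ ℂ^d whose Schmidt rank is at most n. Then |⟨ψ_+, v⟩|² ≤ n/d, where ψ_+ = (1/√d) Σ_i |ii⟩. Consequently, for every positive semidefinite matrix σ of Schmidt number at most n, Tr(P_+ σ) ≤ (n/d) Tr σ, where P_+ = ψ_+ ψ_+†; equivalently, W = 𝟙 − (d/n) P_+ satisfies Tr(Wσ) ≥ 0 for all trace-one positive semidefinite σ of Schmidt number at most n. -/

import Mathlib

open Matrix BigOperators Kronecker ComplexOrder

/-- The d×d matrix `M_v` associated with a vector `v` on ℂ^d ⊗ ℂ^d, `(M_v)_{ij} = v (i,j)`. -/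
def toMat (d : ℕ) (v : Fin d × Fin d → ℂ) : Matrix (Fin d) (Fin d) ℂ :=
  Matrix.of fun i j => v (i, j)

/-- `ρ` has Schmidt number at most `n`: it is a finite sum of `w wᴴ` with each `w` of
Schmidt rank (i.e. rank of the associated d×d matrix) at most `n`. -/
def SchmidtNumberLE (d : ℕ) (ρ : Matrix (Fin d × Fin d) (Fin d × Fin d) ℂ) (n : ℕ) : Prop :=
  ∃ (k : ℕ) (w : Fin k → (Fin d × Fin d → ℂ)),
    (∀ i, (toMat d (w i)).rank ≤ n) ∧
    ρ = ∑ i, Matrix.vecMulVec (w i) (star (w i))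

/-- The maximally entangled unit vector `ψ₊ = (1/√d) Σ_i |ii⟩`. -/
noncomputable def psiPlus (d : ℕ) : Fin d × Fin d → ℂ :=
  fun p => if p.1 = p.2 then (((Real.sqrt d)⁻¹ : ℝ) : ℂ) else 0

/-- `P₊ = ψ₊ ψ₊ᴴ`. -/
noncomputable def Pplus (d : ℕ) : Matrix (Fin d × Fin d) (Fin d × Fin d) ℂ :=
  Matrix.vecMulVec (psiPlus d) (star (psiPlus d))

/-- The squared modulus of the trace is at most the rank times the squared Frobenius norm. -/
theorem Matrix.norm_trace_sq_le_rank_mul {m 𝕜 : Type*} [Fintype m] [RCLike 𝕜]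
    (A : Matrix m m 𝕜) : ‖A.trace‖ ^ 2 ≤ A.rank * ∑ i, ∑ j, ‖A i j‖ ^ 2 := by
  let W : Submodule 𝕜 (EuclideanSpace 𝕜 m) :=
    (Submodule.span 𝕜 (Set.range A.col)).map (WithLp.linearEquiv 2 𝕜 (m → 𝕜)).symm.toLinearMap
  have hW : Module.finrank 𝕜 W = A.rank := by
    rw [A.rank_eq_finrank_span_cols]
    exact LinearEquiv.finrank_map_eq _ _
  let x (j : m) : W := ⟨WithLp.toLp 2 (A.col j),
    Submodule.mem_map_of_mem (Submodule.subset_span ⟨j, rfl⟩)⟩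
  let b := stdOrthonormalBasis 𝕜 W
  have hx (i : m) : A i i = ∑ k, inner 𝕜 (b k) (x i) * (b k : EuclideanSpace 𝕜 m) i := by
    have h := congrArg (fun y : W => (y : EuclideanSpace 𝕜 m) i) (b.sum_repr' (x i))
    simpa [x] using h.symm
  have hc : ∑ p : m × Fin (Module.finrank 𝕜 W), ‖inner 𝕜 (b p.2) (x p.1)‖ ^ 2
      = ∑ i, ∑ j, ‖A i j‖ ^ 2 := by
    rw [Fintype.sum_prod_type, Finset.sum_comm (f := fun i j => ‖A i j‖ ^ 2)]
    refine Finset.sum_congr rfl fun i _ => ?_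
    dsimp only
    rw [b.sum_sq_norm_inner_right, Submodule.coe_norm, EuclideanSpace.norm_sq_eq]
    rfl
  have hb : ∑ p : m × Fin (Module.finrank 𝕜 W), ‖(b p.2 : EuclideanSpace 𝕜 m) p.1‖ ^ 2
      = A.rank := by
    rw [Fintype.sum_prod_type_right, ← hW]
    simp [← EuclideanSpace.norm_sq_eq, ← Submodule.coe_norm]
  calc ‖A.trace‖ ^ 2
      = ‖∑ p : m × Fin (Module.finrank 𝕜 W),
          inner 𝕜 (b p.2) (x p.1) * (b p.2 : EuclideanSpace 𝕜 m) p.1‖ ^ 2 := by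
        rw [Fintype.sum_prod_type, Matrix.trace]
        simp only [Matrix.diag_apply, hx]
    _ ≤ (∑ p : m × Fin (Module.finrank 𝕜 W),
          ‖inner 𝕜 (b p.2) (x p.1)‖ * ‖(b p.2 : EuclideanSpace 𝕜 m) p.1‖) ^ 2 := by
        gcongr
        exact (norm_sum_le _ _).trans_eq (by simp only [norm_mul])
    _ ≤ _ := Finset.sum_mul_sq_le_sq_mul_sq _ _ _
    _ = A.rank * ∑ i, ∑ j, ‖A i j‖ ^ 2 := by rw [hc, hb, mul_comm]

theorem star_psiPlus_dotProduct (d : ℕ) (v : Fin d × Fin d → ℂ) :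
    star (psiPlus d) ⬝ᵥ v = (((Real.sqrt d)⁻¹ : ℝ) : ℂ) * (toMat d v).trace := by
  simp [dotProduct, psiPlus, Fintype.sum_prod_type, apply_ite, ite_mul, Matrix.trace, toMat,
    Finset.mul_sum]

theorem norm_star_psiPlus_dotProduct_sq_le {d n : ℕ} (v : Fin d × Fin d → ℂ)
    (hv : (toMat d v).rank ≤ n) :
    ‖star (psiPlus d) ⬝ᵥ v‖ ^ 2 ≤ (n : ℝ) / d * ∑ p, ‖v p‖ ^ 2 := by
  have h : ‖(toMat d v).trace‖ ^ 2 ≤ n * ∑ p, ‖v p‖ ^ 2 := by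
    rw [Fintype.sum_prod_type]
    refine (Matrix.norm_trace_sq_le_rank_mul (toMat d v)).trans ?_
    gcongr
    rfl
  rw [star_psiPlus_dotProduct, norm_mul, mul_pow, Complex.norm_real, norm_inv, inv_pow,
    Real.norm_eq_abs, sq_abs, Real.sq_sqrt (Nat.cast_nonneg d), div_mul_eq_mul_div, div_eq_inv_mul]
  gcongr

theorem trace_vecMulVec_star {m : Type*} [Fintype m] (w : m → ℂ) :
    (vecMulVec w (star w)).trace = ((∑ p, ‖w p‖ ^ 2 : ℝ) : ℂ) := by
  simp [Matrix.trace_vecMulVec, dotProduct, Complex.mul_conj']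

theorem trace_vecMulVec_star_mul_vecMulVec_star {m : Type*} [Fintype m] (u w : m → ℂ) :
    (vecMulVec u (star u) * vecMulVec w (star w)).trace = ((‖star u ⬝ᵥ w‖ ^ 2 : ℝ) : ℂ) := by
  rw [vecMulVec_mul_vecMulVec, trace_vecMulVec, dotProduct_smul, smul_eq_mul, Complex.ofReal_pow,
    ← Complex.mul_conj', starRingEnd_apply, ← star_dotProduct, dotProduct_comm u]

theorem re_trace_Pplus_mul_le {d n : ℕ} {σ : Matrix (Fin d × Fin d) (Fin d × Fin d) ℂ}
    (hσ : SchmidtNumberLE d σ n) :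
    (Pplus d * σ).trace.re ≤ (n : ℝ) / d * σ.trace.re := by
  obtain ⟨k, w, hw, rfl⟩ := hσ
  simp only [Pplus, Matrix.mul_sum, Matrix.trace_sum, trace_vecMulVec_star,
    trace_vecMulVec_star_mul_vecMulVec_star, Complex.re_sum, Complex.ofReal_re]
  rw [Finset.mul_sum]
  exact Finset.sum_le_sum fun i _ => norm_star_psiPlus_dotProduct_sq_le (w i) (hw i)

/-- Overlap of Schmidt-rank-≤ n vectors with `ψ₊` is at most `n/d`, and the induced
Schmidt witness properties of `𝟙 - (d/n) P₊`. -/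
theorem schmidt_witness_overlap (d n : ℕ) (hd : 1 ≤ d) (hn : 1 ≤ n) (hnd : n ≤ d) :
    (∀ v : Fin d × Fin d → ℂ, (∑ p, ‖v p‖ ^ 2) = 1 → (toMat d v).rank ≤ n →
      ‖star (psiPlus d) ⬝ᵥ v‖ ^ 2 ≤ (n : ℝ) / d) ∧
    (∀ σ : Matrix (Fin d × Fin d) (Fin d × Fin d) ℂ, σ.PosSemidef →
      SchmidtNumberLE d σ n →
      ((Pplus d * σ).trace).re ≤ ((n : ℝ) / d) * (σ.trace).re) ∧
    (∀ σ : Matrix (Fin d × Fin d) (Fin d × Fin d) ℂ, σ.PosSemidef → σ.trace = 1 →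
      SchmidtNumberLE d σ n →
      0 ≤ ((((1 : Matrix (Fin d × Fin d) (Fin d × Fin d) ℂ) - ((d : ℝ) / n) • Pplus d)
        * σ).trace).re) := by
  refine ⟨fun v hv hr => ?_, fun σ _ hσ => re_trace_Pplus_mul_le hσ, fun σ _ htr hσ => ?_⟩
  · simpa [hv] using norm_star_psiPlus_dotProduct_sq_le v hr
  · have h := re_trace_Pplus_mul_le hσ
    have hd' : (0 : ℝ) < d := by exact_mod_cast hd
    have hn' : (0 : ℝ) < n := by exact_mod_cast hn
    rw [htr, Complex.one_re, mul_one, le_div_iff₀ hd'] at h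
    rw [sub_mul, one_mul, smul_mul_assoc, trace_sub, trace_smul, htr, Complex.sub_re,
      Complex.one_re, Complex.smul_re, smul_eq_mul, sub_nonneg, div_mul_eq_mul_div, div_le_one hn']
    linarith
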